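/- arXiv:2206.11940 — 2 statements merged into one kernel-verified Lean document; each statement's English description precedes it below -/
import Mathlib

section
/- Assume the mastery hypotheses. Then for every s ∉ Abs and g ∈ S: if g is reachable from s then V̄*(s, g) ≥ rMIN·D, and if g is not reachable from s then V̄*(s, g) ≤ rMIN·D − rMAX (so in particular V̄*(s, g) < rMIN·D). -/
open Classical

/-- The state reached after `i` steps when starting in `s` and executing the actions in `as`
(deterministic transition function `T`). `stateAt T s as 0 = s` and
`stateAt T s as (i+1) = T (stateAt T s as i) (as[i])`. -/
def stateAt {S A : Type*} (T : S → A → S) (s : S) (as : List A) (i : ℕ) : S :=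
  (as.take i).foldl T s

/-- `as` is a terminating trajectory from `s`: it is nonempty, the final induced state is
absorbing, and no earlier induced state is absorbing. -/
def Terminating {S A : Type*} (T : S → A → S) (Abs : Set S) (s : S) (as : List A) : Prop :=
  as ≠ [] ∧ stateAt T s as as.length ∈ Abs ∧ ∀ i < as.length, stateAt T s as i ∉ Abs

/-- The achieved goal of a trajectory: the state from which the terminal transition is taken. -/
def achievedGoal {S A : Type*} (T : S → A → S) (s : S) (as : List A) : S :=
  stateAt T s as (as.length - 1)

/-- The return of a trajectory under reward function `R`: the sum of the one-step rewards. -/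
def ret {S A : Type*} (T : S → A → S) (R : S → A → S → ℝ) : S → List A → ℝ
  | _, [] => 0
  | s, a :: as => R s a (T s a) + ret T R (T s a) as

/-- The internal goal set: all states from which some action leads to an absorbing state. -/
def goalSet {S A : Type*} (T : S → A → S) (Abs : Set S) : Set S :=
  {s | ∃ a : A, T s a ∈ Abs}

/-- The goal-oriented reward: a penalty `rbMIN` for terminal transitions taken from a state
other than the goal `g`, and the task reward `R` otherwise. -/
noncomputable def Rbar {S A : Type*} (Abs : Set S) (rbMIN : ℝ) (R : S → A → S → ℝ) (g : S) :
    S → A → S → ℝ :=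
  fun s a s' => if s ≠ g ∧ s' ∈ Abs then rbMIN else R s a s'

/-- The optimal value `Q*(s, a)`: the supremum of returns under `R` over terminating
trajectories from `s` whose first action is `a`. -/
noncomputable def Qstar {S A : Type*} (T : S → A → S) (Abs : Set S) (R : S → A → S → ℝ)
    (s : S) (a : A) : ℝ :=
  sSup {x | ∃ as : List A, Terminating T Abs s as ∧ as.head? = some a ∧ ret T R s as = x}

/-- The optimal state value `V*(s) = sup_a Q*(s, a)`. -/
noncomputable def Vstar {S A : Type*} (T : S → A → S) (Abs : Set S) (R : S → A → S → ℝ)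
    (s : S) : ℝ :=
  sSup (Set.range (Qstar T Abs R s))

/-- The optimal world value `Q̄*(s, g, a)`: the optimal value for the goal-oriented reward. -/
noncomputable def Qbar {S A : Type*} (T : S → A → S) (Abs : Set S) (rbMIN : ℝ)
    (R : S → A → S → ℝ) (s g : S) (a : A) : ℝ :=
  Qstar T Abs (Rbar Abs rbMIN R g) s a

/-- The optimal world state value `V̄*(s, g) = sup_a Q̄*(s, g, a)`. -/
noncomputable def Vbar {S A : Type*} (T : S → A → S) (Abs : Set S) (rbMIN : ℝ)
    (R : S → A → S → ℝ) (s g : S) : ℝ :=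
  sSup (Set.range (Qbar T Abs rbMIN R s g))

/-- The environment is proper with horizon `D`: from every non-absorbing state some
terminating trajectory exists, and every terminating trajectory has length at most `D`. -/
def Proper {S A : Type*} (T : S → A → S) (Abs : Set S) (D : ℕ) : Prop :=
  1 ≤ D ∧ (∀ s ∉ Abs, ∃ as : List A, Terminating T Abs s as) ∧
    ∀ (s : S) (as : List A), Terminating T Abs s as → as.length ≤ D

/-- `g` is reachable from `s`: some terminating trajectory from `s` has achieved goal `g`. -/
def Reachable {S A : Type*} (T : S → A → S) (Abs : Set S) (s g : S) : Prop :=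
  ∃ as : List A, Terminating T Abs s as ∧ achievedGoal T s as = g

/-- The optimal terminal reward at a goal state `g`: the supremum of `R(g, a, T(g, a))`
over actions `a` whose transition from `g` is terminal. -/
noncomputable def Rterm {S A : Type*} (T : S → A → S) (Abs : Set S) (R : S → A → S → ℝ)
    (g : S) : ℝ :=
  sSup {x | ∃ a : A, T g a ∈ Abs ∧ R g a (T g a) = x}

theorem terminating_cons {S A : Type*} (T : S → A → S) (Abs : Set S) (s : S) (a : A)
    (as : List A) :
    Terminating T Abs s (a :: as) ↔
      s ∉ Abs ∧ ((as = [] ∧ T s a ∈ Abs) ∨ Terminating T Abs (T s a) as) := by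
  constructor
  · rintro ⟨-, h1, h2⟩
    refine ⟨by simpa [stateAt] using h2 0 (by simp), ?_⟩
    by_cases h : as = []
    · subst h
      left
      exact ⟨rfl, by simpa [stateAt] using h1⟩
    · right
      refine ⟨h, by simpa [stateAt] using h1, fun i hi => ?_⟩
      have := h2 (i + 1) (by simpa using hi)
      simpa [stateAt] using this
  · rintro ⟨hs, ⟨rfl, h⟩ | ⟨h, h1, h2⟩⟩
    · refine ⟨by simp, by simpa [stateAt] using h, fun i hi => ?_⟩
      have : i = 0 := by simpa using hi
      subst this
      simpa [stateAt] using hs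
    · refine ⟨by simp, by simpa [stateAt] using h1, fun i hi => ?_⟩
      cases i with
      | zero => simpa [stateAt] using hs
      | succ i =>
        have := h2 i (by simpa using hi)
        simpa [stateAt] using this

theorem achievedGoal_cons {S A : Type*} (T : S → A → S) (s : S) (a : A)
    (as : List A) (h : as ≠ []) :
    achievedGoal T s (a :: as) = achievedGoal T (T s a) as := by
  cases as with
  | nil => exact absurd rfl h
  | cons b bs => simp [achievedGoal, stateAt]

theorem terminating_start {S A : Type*} (T : S → A → S) (Abs : Set S) (s : S)
    (as : List A) (h : Terminating T Abs s as) : s ∉ Abs := by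
  cases as with
  | nil => exact absurd rfl h.1
  | cons b bs => exact ((terminating_cons T Abs s b bs).1 h).1

theorem ret_bounds {S A : Type*} (T : S → A → S) (Abs : Set S)
    (R : S → A → S → ℝ) (rMIN rMAX rbMIN : ℝ)
    (hbound : ∀ s ∉ Abs, ∀ a : A, rMIN ≤ R s a (T s a) ∧ R s a (T s a) < rMAX)
    (g : S) (as : List A) :
    ∀ s, Terminating T Abs s as →
      (achievedGoal T s as = g → rMIN * as.length ≤ ret T (Rbar Abs rbMIN R g) s as ∧
        ret T (Rbar Abs rbMIN R g) s as ≤ rMAX * as.length) ∧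
      (achievedGoal T s as ≠ g →
        ret T (Rbar Abs rbMIN R g) s as ≤ rMAX * ((as.length : ℝ) - 1) + rbMIN) := by
  induction as with
  | nil => intro s h; exact absurd rfl h.1
  | cons a as ih =>
    intro s h
    obtain ⟨hs, ⟨rfl, h1⟩ | h1⟩ := (terminating_cons T Abs s a as).1 h
    · have hb := hbound s hs a
      have hg : achievedGoal T s [a] = s := by simp [achievedGoal, stateAt]
      rw [hg]
      refine ⟨fun e => ?_, fun e => ?_⟩
      · simp only [ret, Rbar, e, ne_eq, not_true_eq_false, false_and, if_false]
        rw [e] at hb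
        simp only [List.length_cons, List.length_nil]
        push_cast
        constructor <;> linarith [hb.1, hb.2]
      · simp [ret, Rbar, e, h1]
    · have hb := hbound s hs a
      have hn := terminating_start T Abs _ _ h1
      rw [achievedGoal_cons T s a as h1.1]
      obtain ⟨i1, i2⟩ := ih _ h1
      have hr : ret T (Rbar Abs rbMIN R g) s (a :: as) =
          R s a (T s a) + ret T (Rbar Abs rbMIN R g) (T s a) as := by
        simp [ret, Rbar, hn]
      rw [hr]
      simp only [List.length_cons]
      push_cast
      refine ⟨fun e => ?_, fun e => ?_⟩
      · have := i1 e
        constructor <;> nlinarith [hb.1, hb.2, this.1, this.2]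
      · have := i2 e
        nlinarith [hb.1, hb.2]

/-- Value bounds separating reachable from unreachable goals: under the mastery hypotheses,
`V̄*(s, g) ≥ rMIN·D` if `g` is reachable from `s`, and `V̄*(s, g) ≤ rMIN·D − rMAX` otherwise. -/
theorem vbar_reachable_bounds {S A : Type*} (T : S → A → S) (Abs : Set S)
    (R : S → A → S → ℝ) (rMIN rMAX rbMIN : ℝ) (D : ℕ)
    (hProper : Proper T Abs D)
    (hbound : ∀ s ∉ Abs, ∀ a : A, rMIN ≤ R s a (T s a) ∧ R s a (T s a) < rMAX)
    (hrMIN : rMIN ≤ 0) (hrMAX : 0 < rMAX)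
    (hrb : rbMIN = (rMIN - rMAX) * D) :
    ∀ s ∉ Abs, ∀ g : S,
      (Reachable T Abs s g → rMIN * D ≤ Vbar T Abs rbMIN R s g) ∧
      (¬ Reachable T Abs s g → Vbar T Abs rbMIN R s g ≤ rMIN * D - rMAX) := by
  intro s hs g
  obtain ⟨hD, hex, hlen⟩ := hProper
  have hD1 : (1 : ℝ) ≤ D := by exact_mod_cast hD
  have key := ret_bounds T Abs R rMIN rMAX rbMIN hbound g
  have hl : ∀ as, Terminating T Abs s as → (as.length : ℝ) ≤ D := fun as h => by
    exact_mod_cast hlen s as h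
  have hne : ∀ a : A, ∃ as : List A, Terminating T Abs s as ∧ as.head? = some a := by
    intro a
    by_cases h : T s a ∈ Abs
    · exact ⟨[a], (terminating_cons T Abs s a []).2 ⟨hs, Or.inl ⟨rfl, h⟩⟩, rfl⟩
    · obtain ⟨as, has⟩ := hex _ h
      exact ⟨a :: as, (terminating_cons T Abs s a as).2 ⟨hs, Or.inr has⟩, rfl⟩
  have hneA : Nonempty A := by
    obtain ⟨as, has⟩ := hex s hs
    cases as with
    | nil => exact absurd rfl has.1
    | cons a _ => exact ⟨a⟩
  have hun : ∀ as, Terminating T Abs s as → achievedGoal T s as ≠ g →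
      ret T (Rbar Abs rbMIN R g) s as ≤ rMIN * D - rMAX := by
    intro as h e
    have h1 := (key as s h).2 e
    have h2 := mul_le_mul_of_nonneg_left (hl as h) hrMAX.le
    rw [hrb] at h1 ⊢
    linarith
  have hup : ∀ as, Terminating T Abs s as →
      ret T (Rbar Abs rbMIN R g) s as ≤ rMAX * D := by
    intro as h
    by_cases e : achievedGoal T s as = g
    · have h1 := ((key as s h).1 e).2
      have h2 := mul_le_mul_of_nonneg_left (hl as h) hrMAX.le
      linarith
    · have h1 := hun as h e
      nlinarith
  constructor
  · rintro ⟨as, has, hg⟩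
    obtain ⟨a, ha⟩ : ∃ a, as.head? = some a := by
      cases as with
      | nil => exact absurd rfl has.1
      | cons a _ => exact ⟨a, rfl⟩
    have h1 := ((key as s has).1 hg).1
    have h2 := mul_le_mul_of_nonpos_left (hl as has) hrMIN
    have h3 : ret T (Rbar Abs rbMIN R g) s as ≤ Qbar T Abs rbMIN R s g a := by
      refine le_csSup ⟨rMAX * D, ?_⟩ ⟨as, has, ha, rfl⟩
      rintro x ⟨bs, hbs, -, rfl⟩
      exact hup bs hbs
    have h4 : Qbar T Abs rbMIN R s g a ≤ Vbar T Abs rbMIN R s g := by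
      refine le_csSup ⟨rMAX * D, ?_⟩ ⟨a, rfl⟩
      rintro x ⟨b, rfl⟩
      obtain ⟨bs, hbs, hb⟩ := hne b
      refine csSup_le ⟨_, bs, hbs, hb, rfl⟩ ?_
      rintro x ⟨cs, hcs, -, rfl⟩
      exact hup cs hcs
    linarith
  · intro hnr
    refine csSup_le (Set.range_nonempty _) ?_
    rintro x ⟨b, rfl⟩
    obtain ⟨bs, hbs, hb⟩ := hne b
    refine csSup_le ⟨_, bs, hbs, hb, rfl⟩ ?_
    rintro x ⟨cs, hcs, -, rfl⟩
    exact hun cs hcs (fun e => hnr ⟨cs, hcs, e⟩)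
end

section
/- Let R₁ and R₂ be two reward functions on the same environment that agree on non-terminal transitions, each satisfying the mastery hypotheses with the same rMIN, rMAX, D and r̄MIN. Then for every s ∉ Abs, every g ∈ S with s ≠ g, and every a ∈ A: a attains the supremum of Q̄*₁(s, g, ·) over A (i.e. Q̄*₁(s, g, a) = sup_{a′ ∈ A} Q̄*₁(s, g, a′)) if and only if a attains the supremum of Q̄*₂(s, g, ·) over A. In other words, tasks sharing the same dynamics and non-terminal rewards have the same optimal world policies. -/
open Classical

/-- All states visited along `p` from `s` (including the last) are non-absorbing. -/
def NA {S A : Type*} (T : S → A → S) (Abs : Set S) : S → List A → Prop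
  | s, [] => s ∉ Abs
  | s, a :: p => s ∉ Abs ∧ NA T Abs (T s a) p

theorem NA.head {S A : Type*} {T : S → A → S} {Abs : Set S} {s : S} {p : List A}
    (h : NA T Abs s p) : s ∉ Abs := by
  cases p with
  | nil => exact h
  | cons a p => exact h.1

theorem NA.last {S A : Type*} {T : S → A → S} {Abs : Set S} {s : S} {p : List A}
    (h : NA T Abs s p) : p.foldl T s ∉ Abs := by
  induction p generalizing s with
  | nil => exact h
  | cons a p ih => exact ih h.2

theorem term_cons {S A : Type*} (T : S → A → S) (Abs : Set S) (s : S) (a : A) (l : List A)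
    (hl : l ≠ []) :
    Terminating T Abs s (a :: l) ↔ s ∉ Abs ∧ Terminating T Abs (T s a) l := by
  unfold Terminating stateAt
  constructor
  · rintro ⟨-, h1, h2⟩
    refine ⟨by simpa using h2 0 (by simp), hl, by simpa using h1, fun i hi => ?_⟩
    simpa using h2 (i + 1) (by simpa using hi)
  · rintro ⟨h0, -, h1, h2⟩
    refine ⟨by simp, by simpa using h1, fun i hi => ?_⟩
    cases i with
    | zero => simpa using h0
    | succ i => simpa using h2 i (by simpa using hi)

theorem term_snoc {S A : Type*} (T : S → A → S) (Abs : Set S) (s : S) (p : List A) (b : A) :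
    Terminating T Abs s (p ++ [b]) ↔ NA T Abs s p ∧ T (p.foldl T s) b ∈ Abs := by
  induction p generalizing s with
  | nil =>
    unfold Terminating stateAt
    simp [NA, and_comm]
  | cons a p ih =>
    rw [List.cons_append, term_cons _ _ _ _ _ (by simp), ih]
    simp [NA, and_assoc]

theorem term_exists {S A : Type*} {T : S → A → S} {Abs : Set S} {s : S} {l : List A}
    (h : Terminating T Abs s l) :
    ∃ p b, l = p ++ [b] ∧ NA T Abs s p ∧ T (p.foldl T s) b ∈ Abs := by
  have h1 := List.dropLast_append_getLast h.1
  refine ⟨l.dropLast, l.getLast h.1, h1.symm, ?_⟩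
  rw [← term_snoc, h1]
  exact h

theorem ret_snoc {S A : Type*} (T : S → A → S) (R : S → A → S → ℝ) (s : S) (p : List A) (b : A) :
    ret T R s (p ++ [b]) = ret T R s p + R (p.foldl T s) b (T (p.foldl T s) b) := by
  induction p generalizing s with
  | nil => simp [ret]
  | cons a p ih => simp [ret, ih, add_assoc]

theorem ret_agree {S A : Type*} (T : S → A → S) (Abs : Set S) (R₁ R₂ : S → A → S → ℝ) (m : ℝ)
    (g : S) (hagree : ∀ (s : S) (a : A), T s a ∉ Abs → R₁ s a (T s a) = R₂ s a (T s a))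
    (s : S) (p : List A) (h : NA T Abs s p) :
    ret T (Rbar Abs m R₁ g) s p = ret T (Rbar Abs m R₂ g) s p := by
  induction p generalizing s with
  | nil => rfl
  | cons a p ih =>
    have h1 := h.2.head
    simp only [ret, ih _ h.2, Rbar, h1, and_false, if_false, hagree s a h1]

theorem ret_bound {S A : Type*} (T : S → A → S) (Abs : Set S) (R : S → A → S → ℝ) (m : ℝ)
    (g : S) (rMIN rMAX : ℝ)
    (hb : ∀ s ∉ Abs, ∀ a : A, rMIN ≤ R s a (T s a) ∧ R s a (T s a) < rMAX)
    (s : S) (p : List A) (h : NA T Abs s p) :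
    p.length * rMIN ≤ ret T (Rbar Abs m R g) s p ∧
      ret T (Rbar Abs m R g) s p ≤ p.length * rMAX := by
  induction p generalizing s with
  | nil => simp [ret]
  | cons a p ih =>
    have h1 := h.2.head
    have h2 := ih _ h.2
    have h3 := hb s h.1 a
    have h4 : Rbar Abs m R g s a (T s a) = R s a (T s a) := by simp [Rbar, h1]
    simp only [ret, h4, List.length_cons]
    push_cast
    constructor <;> linarith [h2.1, h2.2, h3.1, h3.2]

/-- Set of returns for first action `a`. -/
def RS {S A : Type*} (T : S → A → S) (Abs : Set S) (R : S → A → S → ℝ) (s : S) (a : A) : Set ℝ :=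
  {x | ∃ as : List A, Terminating T Abs s as ∧ as.head? = some a ∧ ret T R s as = x}

/-- Some terminating trajectory with first action `a` achieves `g`. -/
def Gd {S A : Type*} (T : S → A → S) (Abs : Set S) (s g : S) (a : A) : Prop :=
  ∃ p b, NA T Abs s p ∧ T (p.foldl T s) b ∈ Abs ∧ (p ++ [b]).head? = some a ∧ p.foldl T s = g

theorem mem_RS {S A : Type*} {T : S → A → S} {Abs : Set S} {R : S → A → S → ℝ} {s : S} {a : A}
    {x : ℝ} : x ∈ RS T Abs R s a ↔ ∃ p b, NA T Abs s p ∧ T (p.foldl T s) b ∈ Abs ∧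
      (p ++ [b]).head? = some a ∧
      ret T R s p + R (p.foldl T s) b (T (p.foldl T s) b) = x := by
  constructor
  · rintro ⟨l, h1, h2, h3⟩
    obtain ⟨p, b, rfl, h4, h5⟩ := term_exists h1
    exact ⟨p, b, h4, h5, h2, by rw [← ret_snoc, h3]⟩
  · rintro ⟨p, b, h1, h2, h3, h4⟩
    exact ⟨p ++ [b], (term_snoc ..).2 ⟨h1, h2⟩, h3, by rw [ret_snoc, h4]⟩

section
variable {S A : Type*} {T : S → A → S} {Abs : Set S} {R R₁ R₂ : S → A → S → ℝ}
  {rMIN rMAX rbMIN : ℝ} {D : ℕ}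

theorem RS_nonempty (hP : Proper T Abs D) (s : S) (hs : s ∉ Abs) (a : A) :
    (RS T Abs R s a).Nonempty := by
  by_cases h : T s a ∈ Abs
  · exact ⟨_, mem_RS.2 ⟨[], a, hs, h, rfl, rfl⟩⟩
  · obtain ⟨l, hl⟩ := hP.2.1 _ h
    exact ⟨_, a :: l, (term_cons _ _ _ _ _ hl.1).2 ⟨hs, hl⟩, rfl, rfl⟩

theorem len_le (hP : Proper T Abs D) {s : S} {p : List A} {b : A} (h : NA T Abs s p)
    (hb : T (p.foldl T s) b ∈ Abs) : (p.length : ℝ) + 1 ≤ D := by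
  have := hP.2.2 s (p ++ [b]) ((term_snoc ..).2 ⟨h, hb⟩)
  simp at this
  exact_mod_cast this

theorem bad_le (hP : Proper T Abs D)
    (hb : ∀ s ∉ Abs, ∀ a : A, rMIN ≤ R s a (T s a) ∧ R s a (T s a) < rMAX)
    (hrMAX : 0 < rMAX) (hrb : rbMIN = (rMIN - rMAX) * D)
    {s g : S} {p : List A} {b : A} (h : NA T Abs s p)
    (hT : T (p.foldl T s) b ∈ Abs) (hg : p.foldl T s ≠ g) :
    ret T (Rbar Abs rbMIN R g) s p +
      Rbar Abs rbMIN R g (p.foldl T s) b (T (p.foldl T s) b) ≤ D * rMIN - rMAX := by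
  have h1 := (ret_bound T Abs R rbMIN g rMIN rMAX hb s p h).2
  have h2 := len_le hP h hT
  have h3 : Rbar Abs rbMIN R g (p.foldl T s) b (T (p.foldl T s) b) = rbMIN := by
    simp [Rbar, hT, hg]
  rw [h3]
  nlinarith

theorem good_val {s g : S} {p : List A} {b : A} (hg : p.foldl T s = g) :
    Rbar Abs rbMIN R g (p.foldl T s) b (T (p.foldl T s) b) = R g b (T g b) := by
  simp [Rbar, hg]

theorem good_bd (hP : Proper T Abs D)
    (hb : ∀ s ∉ Abs, ∀ a : A, rMIN ≤ R s a (T s a) ∧ R s a (T s a) < rMAX)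
    (hrMIN : rMIN ≤ 0) (hrMAX : 0 < rMAX)
    {s g : S} {p : List A} {b : A} (h : NA T Abs s p)
    (hT : T (p.foldl T s) b ∈ Abs) (hg : p.foldl T s = g) :
    D * rMIN ≤ ret T (Rbar Abs rbMIN R g) s p +
      Rbar Abs rbMIN R g (p.foldl T s) b (T (p.foldl T s) b) ∧
    ret T (Rbar Abs rbMIN R g) s p +
      Rbar Abs rbMIN R g (p.foldl T s) b (T (p.foldl T s) b) ≤ D * rMAX := by
  have h1 := ret_bound T Abs R rbMIN g rMIN rMAX hb s p h
  have h2 := len_le hP h hT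
  rw [good_val hg]
  have h3 := hb g (hg ▸ h.last) b
  constructor <;> nlinarith [h1.1, h1.2, h3.1, h3.2]

theorem RS_le (hP : Proper T Abs D)
    (hb : ∀ s ∉ Abs, ∀ a : A, rMIN ≤ R s a (T s a) ∧ R s a (T s a) < rMAX)
    (hrMIN : rMIN ≤ 0) (hrMAX : 0 < rMAX) (hrb : rbMIN = (rMIN - rMAX) * D) (s g : S) (a : A) :
    ∀ x ∈ RS T Abs (Rbar Abs rbMIN R g) s a, x ≤ D * rMAX := by
  intro x hx
  obtain ⟨p, b, h1, h2, -, rfl⟩ := mem_RS.1 hx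
  by_cases hg : p.foldl T s = g
  · exact (good_bd hP hb hrMIN hrMAX h1 h2 hg).2
  · have := bad_le hP hb hrMAX hrb h1 h2 hg
    have hD : (0 : ℝ) ≤ D := Nat.cast_nonneg D
    nlinarith

theorem RS_bdd (hP : Proper T Abs D)
    (hb : ∀ s ∉ Abs, ∀ a : A, rMIN ≤ R s a (T s a) ∧ R s a (T s a) < rMAX)
    (hrMIN : rMIN ≤ 0) (hrMAX : 0 < rMAX) (hrb : rbMIN = (rMIN - rMAX) * D) (s g : S) (a : A) :
    BddAbove (RS T Abs (Rbar Abs rbMIN R g) s a) :=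
  ⟨D * rMAX, RS_le hP hb hrMIN hrMAX hrb s g a⟩

theorem attains_iff (hP : Proper T Abs D)
    (hb : ∀ s ∉ Abs, ∀ a : A, rMIN ≤ R s a (T s a) ∧ R s a (T s a) < rMAX)
    (hrMIN : rMIN ≤ 0) (hrMAX : 0 < rMAX) (hrb : rbMIN = (rMIN - rMAX) * D) (s g : S)
    (hs : s ∉ Abs) (a : A) :
    Qbar T Abs rbMIN R s g a = Vbar T Abs rbMIN R s g ↔
      ∀ b, Qbar T Abs rbMIN R s g b ≤ Qbar T Abs rbMIN R s g a := by
  have hbdd : BddAbove (Set.range (Qbar T Abs rbMIN R s g)) := by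
    refine ⟨D * rMAX, ?_⟩
    rintro _ ⟨b, rfl⟩
    exact csSup_le (RS_nonempty hP s hs b) (RS_le hP hb hrMIN hrMAX hrb s g b)
  constructor
  · intro h b
    rw [h]
    exact le_csSup hbdd ⟨b, rfl⟩
  · intro h
    apply le_antisymm
    · exact le_csSup hbdd ⟨a, rfl⟩
    · refine csSup_le (Set.range_nonempty_iff_nonempty.2 ⟨a⟩) ?_
      rintro _ ⟨b, rfl⟩
      exact h b

theorem Q_good (hP : Proper T Abs D)
    (hb : ∀ s ∉ Abs, ∀ a : A, rMIN ≤ R s a (T s a) ∧ R s a (T s a) < rMAX)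
    (hrMIN : rMIN ≤ 0) (hrMAX : 0 < rMAX) (hrb : rbMIN = (rMIN - rMAX) * D) (s g : S)
    (a : A) (hG : Gd T Abs s g a) : D * rMIN ≤ Qbar T Abs rbMIN R s g a := by
  obtain ⟨p, b, h1, h2, h3, h4⟩ := hG
  exact (good_bd hP hb hrMIN hrMAX h1 h2 h4).1.trans
    (le_csSup (RS_bdd hP hb hrMIN hrMAX hrb s g a) (mem_RS.2 ⟨p, b, h1, h2, h3, rfl⟩))

theorem Q_bad (hP : Proper T Abs D)
    (hb : ∀ s ∉ Abs, ∀ a : A, rMIN ≤ R s a (T s a) ∧ R s a (T s a) < rMAX)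
    (hrMAX : 0 < rMAX) (hrb : rbMIN = (rMIN - rMAX) * D) (s g : S) (hs : s ∉ Abs)
    (a : A) (hG : ¬ Gd T Abs s g a) : Qbar T Abs rbMIN R s g a < D * rMIN := by
  have : Qbar T Abs rbMIN R s g a ≤ D * rMIN - rMAX := by
    refine csSup_le (RS_nonempty hP s hs a) ?_
    intro x hx
    obtain ⟨p, b, h1, h2, h3, rfl⟩ := mem_RS.1 hx
    exact bad_le hP hb hrMAX hrb h1 h2 (fun h => hG ⟨p, b, h1, h2, h3, h⟩)
  linarith

theorem Q_bad_eq
    (hagree : ∀ (s : S) (a : A), T s a ∉ Abs → R₁ s a (T s a) = R₂ s a (T s a)) (s g : S)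
    (a : A) (hG : ¬ Gd T Abs s g a) :
    Qbar T Abs rbMIN R₁ s g a = Qbar T Abs rbMIN R₂ s g a := by
  have : RS T Abs (Rbar Abs rbMIN R₁ g) s a = RS T Abs (Rbar Abs rbMIN R₂ g) s a := by
    ext x
    rw [mem_RS, mem_RS]
    refine exists_congr fun p => exists_congr fun b => and_congr_right fun h1 =>
      and_congr_right fun h2 => and_congr_right fun h3 => ?_
    have hg : p.foldl T s ≠ g := fun h => hG ⟨p, b, h1, h2, h3, h⟩
    rw [ret_agree T Abs R₁ R₂ rbMIN g hagree s p h1]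
    simp [Rbar, h2, hg]
  exact congrArg sSup this

theorem Q_good_le (hP : Proper T Abs D)
    (hagree : ∀ (s : S) (a : A), T s a ∉ Abs → R₁ s a (T s a) = R₂ s a (T s a))
    (hb₁ : ∀ s ∉ Abs, ∀ a : A, rMIN ≤ R₁ s a (T s a) ∧ R₁ s a (T s a) < rMAX)
    (hb₂ : ∀ s ∉ Abs, ∀ a : A, rMIN ≤ R₂ s a (T s a) ∧ R₂ s a (T s a) < rMAX)
    (hrMIN : rMIN ≤ 0) (hrMAX : 0 < rMAX) (hrb : rbMIN = (rMIN - rMAX) * D) (s g : S)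
    (hs : s ∉ Abs) (hsg : s ≠ g) (a : A) (hG : Gd T Abs s g a) :
    Qbar T Abs rbMIN R₂ s g a ≤
      Qbar T Abs rbMIN R₁ s g a + (Rterm T Abs R₂ g - Rterm T Abs R₁ g) := by
  have good : ∀ p b, NA T Abs s p → T (p.foldl T s) b ∈ Abs → (p ++ [b]).head? = some a →
      p.foldl T s = g → ret T (Rbar Abs rbMIN R₂ g) s p +
        Rbar Abs rbMIN R₂ g (p.foldl T s) b (T (p.foldl T s) b) ≤
      Qbar T Abs rbMIN R₁ s g a + (Rterm T Abs R₂ g - Rterm T Abs R₁ g) := by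
    intro p b h1 h2 h3 h4
    have hgA : g ∉ Abs := h4 ▸ h1.last
    have hTb : T g b ∈ Abs := by rw [h4] at h2; exact h2
    rw [good_val h4, ← ret_agree T Abs R₁ R₂ rbMIN g hagree s p h1]
    have e1 : R₂ g b (T g b) ≤ Rterm T Abs R₂ g := by
      refine le_csSup ⟨rMAX, ?_⟩ ⟨b, hTb, rfl⟩
      rintro _ ⟨c, -, rfl⟩
      exact (hb₂ g hgA c).2.le
    have e2 : Rterm T Abs R₁ g ≤
        Qbar T Abs rbMIN R₁ s g a - ret T (Rbar Abs rbMIN R₁ g) s p := by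
      refine csSup_le ⟨_, b, hTb, rfl⟩ ?_
      rintro _ ⟨c, hc, rfl⟩
      rw [le_sub_iff_add_le']
      refine le_csSup (RS_bdd hP hb₁ hrMIN hrMAX hrb s g a)
        (mem_RS.2 ⟨p, c, h1, by rw [h4]; exact hc, ?_, by rw [good_val h4]⟩)
      cases p with
      | nil => exact absurd h4 hsg
      | cons d p => simpa using h3
    linarith
  refine csSup_le (RS_nonempty hP s hs a) ?_
  intro x hx
  obtain ⟨p, b, h1, h2, h3, rfl⟩ := mem_RS.1 hx
  by_cases h4 : p.foldl T s = g
  · exact good p b h1 h2 h3 h4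
  · obtain ⟨q, c, k1, k2, k3, k4⟩ := hG
    have i1 := good q c k1 k2 k3 k4
    have i2 := (good_bd (rbMIN := rbMIN) hP hb₂ hrMIN hrMAX k1 k2 k4).1
    have i3 := bad_le hP hb₂ hrMAX hrb h1 h2 h4
    linarith

theorem attain_imp (hP : Proper T Abs D)
    (hagree : ∀ (s : S) (a : A), T s a ∉ Abs → R₁ s a (T s a) = R₂ s a (T s a))
    (hb₁ : ∀ s ∉ Abs, ∀ a : A, rMIN ≤ R₁ s a (T s a) ∧ R₁ s a (T s a) < rMAX)
    (hb₂ : ∀ s ∉ Abs, ∀ a : A, rMIN ≤ R₂ s a (T s a) ∧ R₂ s a (T s a) < rMAX)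
    (hrMIN : rMIN ≤ 0) (hrMAX : 0 < rMAX) (hrb : rbMIN = (rMIN - rMAX) * D) (s g : S)
    (hs : s ∉ Abs) (hsg : s ≠ g) (a : A)
    (h : ∀ b, Qbar T Abs rbMIN R₁ s g b ≤ Qbar T Abs rbMIN R₁ s g a) (b : A) :
    Qbar T Abs rbMIN R₂ s g b ≤ Qbar T Abs rbMIN R₂ s g a := by
  have hab := h b
  by_cases ha : Gd T Abs s g a
  · by_cases hb : Gd T Abs s g b
    · have i1 := Q_good_le hP hagree hb₁ hb₂ hrMIN hrMAX hrb s g hs hsg b hb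
      have i2 := Q_good_le hP (fun s a h => (hagree s a h).symm) hb₂ hb₁ hrMIN hrMAX hrb
        s g hs hsg a ha
      linarith
    · have i1 := Q_bad hP hb₂ hrMAX hrb s g hs b hb
      have i2 := Q_good hP hb₂ hrMIN hrMAX hrb s g a ha
      linarith
  · by_cases hb : Gd T Abs s g b
    · have i1 := Q_bad hP hb₁ hrMAX hrb s g hs a ha
      have i2 := Q_good hP hb₁ hrMIN hrMAX hrb s g b hb
      linarith
    · rw [← Q_bad_eq hagree s g a ha, ← Q_bad_eq hagree s g b hb]
      exact hab

end

/-- **Theorem 3**: tasks sharing the same dynamics and non-terminal rewards have the same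
optimal world policies: for `s ∉ Abs` with `s ≠ g`, an action attains `sup_{a'} Q̄*₁(s, g, a')`
iff it attains `sup_{a'} Q̄*₂(s, g, a')`. -/
theorem same_world_policies {S A : Type*} (T : S → A → S) (Abs : Set S)
    (R₁ R₂ : S → A → S → ℝ) (rMIN rMAX rbMIN : ℝ) (D : ℕ)
    (hProper : Proper T Abs D)
    (hagree : ∀ (s : S) (a : A), T s a ∉ Abs → R₁ s a (T s a) = R₂ s a (T s a))
    (hbound₁ : ∀ s ∉ Abs, ∀ a : A, rMIN ≤ R₁ s a (T s a) ∧ R₁ s a (T s a) < rMAX)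
    (hbound₂ : ∀ s ∉ Abs, ∀ a : A, rMIN ≤ R₂ s a (T s a) ∧ R₂ s a (T s a) < rMAX)
    (hrMIN : rMIN ≤ 0) (hrMAX : 0 < rMAX)
    (hrb : rbMIN = (rMIN - rMAX) * D) :
    ∀ s ∉ Abs, ∀ g : S, s ≠ g → ∀ a : A,
      (Qbar T Abs rbMIN R₁ s g a = Vbar T Abs rbMIN R₁ s g ↔
        Qbar T Abs rbMIN R₂ s g a = Vbar T Abs rbMIN R₂ s g) := by
  intro s hs g hsg a
  rw [attains_iff hProper hbound₁ hrMIN hrMAX hrb s g hs a,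
    attains_iff hProper hbound₂ hrMIN hrMAX hrb s g hs a]
  exact ⟨attain_imp hProper hagree hbound₁ hbound₂ hrMIN hrMAX hrb s g hs hsg a,
    attain_imp hProper (fun s a h => (hagree s a h).symm) hbound₂ hbound₁ hrMIN hrMAX hrb
      s g hs hsg a⟩
end
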